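/- arXiv:2501.00285 — 2 statements merged into one kernel-verified Lean document; each statement's English description precedes it below -/
import Mathlib

section
/- The rank of the injective partial Catalan monoid IC_n as a semigroup is 2n; that is, the least cardinality of a subset A ⊆ IC_n whose generated subsemigroup equals IC_n is 2n. -/
open scoped Classical

namespace ICCatalan

/-- Partial injective transformations on `Fin n` (representing the chain `[n] = {1,…,n}`). -/
abbrev PT (n : ℕ) := Fin n ≃. Fin n

/-- Composition (left-to-right, `x(αβ) = (xα)β`) makes `PT n` a monoid. -/
noncomputable instance instMonoidPT (n : ℕ) : Monoid (PT n) where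
  mul f g := f.trans g
  one := PEquiv.refl (Fin n)
  mul_assoc := PEquiv.trans_assoc
  one_mul := PEquiv.refl_trans
  mul_one := PEquiv.trans_refl

lemma mul_def {n : ℕ} (f g : PT n) : f * g = f.trans g := rfl

/-- The domain of a partial transformation. -/
def pdom {n : ℕ} (f : PT n) : Set (Fin n) := {x | ∃ y, f x = some y}

/-- The image of a partial transformation. -/
def pim {n : ℕ} (f : PT n) : Set (Fin n) := {y | ∃ x, f x = some y}

/-- The height `|im f|` of a partial transformation. -/
noncomputable def height {n : ℕ} (f : PT n) : ℕ := (pim f).ncard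

/-- `f` is order-decreasing: `xf ≤ x` on the domain. -/
def IsDecr {n : ℕ} (f : PT n) : Prop := ∀ x y : Fin n, f x = some y → y ≤ x

/-- `f` is isotone: `x ≤ y` implies `xf ≤ yf` on the domain. -/
def IsIso {n : ℕ} (f : PT n) : Prop :=
  ∀ x₁ x₂ y₁ y₂ : Fin n, f x₁ = some y₁ → f x₂ = some y₂ → x₁ ≤ x₂ → y₁ ≤ y₂

/-- The injective partial Catalan monoid `IC_n`: all isotone order-decreasing
partial injective transformations of `[n]`. -/
def IC (n : ℕ) : Set (PT n) := {f | IsIso f ∧ IsDecr f}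

/-- `Q'_n = {α ∈ IC_n : 1 ∉ dom α}` (the least element of `Fin n` plays the role of `1 ∈ [n]`). -/
def Qp (n : ℕ) : Set (PT n) := {f | f ∈ IC n ∧ ∀ x : Fin n, (x : ℕ) = 0 → f x = none}

/-- `S¹ : S` with an identity adjoined (realized inside `PT n`). -/
def SOne {n : ℕ} (S : Set (PT n)) : Set (PT n) := S ∪ {1}

/-- The starred Green relation `L*` of the subsemigroup `S`. -/
def LStar {n : ℕ} (S : Set (PT n)) (a b : PT n) : Prop :=
  ∀ x ∈ SOne S, ∀ y ∈ SOne S, (a * x = a * y ↔ b * x = b * y)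

/-- The starred Green relation `R*` of the subsemigroup `S`. -/
def RStar {n : ℕ} (S : Set (PT n)) (a b : PT n) : Prop :=
  ∀ x ∈ SOne S, ∀ y ∈ SOne S, (x * a = y * a ↔ x * b = y * b)

/-- The starred Green relation `H* = L* ∩ R*`. -/
def HStar {n : ℕ} (S : Set (PT n)) (a b : PT n) : Prop :=
  LStar S a b ∧ RStar S a b

/-- The partial identity on a subset `A` of `[n]`. -/
noncomputable def pid {n : ℕ} (A : Set (Fin n)) : PT n := PEquiv.ofSet A

/-- An essential element: exactly one point `y` of the domain is moved, and `yf = y - 1`. -/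
def IsEssential {n : ℕ} (f : PT n) : Prop :=
  ∃ y z : Fin n, f y = some z ∧ (z : ℕ) + 1 = (y : ℕ) ∧
    ∀ x w : Fin n, f x = some w → w ≠ x → x = y

/-- The shift of `f`: the number of non-fixed points of its domain. -/
noncomputable def shift {n : ℕ} (f : PT n) : ℕ := {x : Fin n | ∃ w, f x = some w ∧ w ≠ x}.ncard


lemma mul_apply_eq_some {n : ℕ} {f g : PT n} {x z : Fin n} :
    (f * g) x = some z ↔ ∃ y, f x = some y ∧ g y = some z :=
  PEquiv.trans_eq_some f g x z

lemma mul_apply_of_eq_some {n : ℕ} {f g : PT n} {x y : Fin n} (h : f x = some y) :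
    (f * g) x = g y := by
  rw [mul_def]
  simp [PEquiv.trans, h]

lemma mul_apply_of_eq_none {n : ℕ} {f g : PT n} {x : Fin n} (h : f x = none) :
    (f * g) x = none := by
  rw [mul_def]
  simp [PEquiv.trans, h]

lemma one_apply {n : ℕ} (x : Fin n) : (1 : PT n) x = some x := rfl

lemma pid_apply {n : ℕ} (A : Set (Fin n)) (x : Fin n) :
    pid A x = if x ∈ A then some x else none := rfl

/-- The partial transformation which removes `i` from the domain and moves `j` to `i`,
fixing all other points; for `j = i` it is the partial identity on the complement of `i`. -/
noncomputable def hole {n : ℕ} (i j : Fin n) : PT n :=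
  pid {i}ᶜ * (Equiv.swap i j).toPEquiv

lemma hole_apply {n : ℕ} (i j x : Fin n) :
    hole i j x = if x = i then none else if x = j then some i else some x := by
  by_cases h : x = i
  · rw [if_pos h, hole, mul_apply_of_eq_none]
    simp [pid_apply, h]
  · rw [if_neg h, hole, mul_apply_of_eq_some (y := x) (by simp [pid_apply, h]),
      Equiv.toPEquiv_apply, Equiv.swap_apply_def, if_neg h]
    split_ifs <;> rfl

lemma hole_self {n : ℕ} (i : Fin n) : hole i i = pid {i}ᶜ := by
  ext1 x
  rw [hole_apply, pid_apply]
  by_cases h : x = i <;> simp [h]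

lemma IC.mul {n : ℕ} {a b : PT n} (ha : a ∈ IC n) (hb : b ∈ IC n) : a * b ∈ IC n := by
  constructor
  · intro x₁ x₂ z₁ z₂ h₁ h₂ hx
    obtain ⟨y₁, h₁, h₁'⟩ := mul_apply_eq_some.1 h₁
    obtain ⟨y₂, h₂, h₂'⟩ := mul_apply_eq_some.1 h₂
    exact hb.1 _ _ _ _ h₁' h₂' (ha.1 _ _ _ _ h₁ h₂ hx)
  · intro x z h
    obtain ⟨y, h, h'⟩ := mul_apply_eq_some.1 h
    exact (hb.2 _ _ h').trans (ha.2 _ _ h)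

lemma one_mem_IC (n : ℕ) : (1 : PT n) ∈ IC n := by
  constructor
  · intro x₁ x₂ y₁ y₂ h₁ h₂ hx
    rw [one_apply, Option.some_inj] at h₁ h₂
    rwa [← h₁, ← h₂]
  · intro x y h
    rw [one_apply, Option.some_inj] at h
    exact h.ge

lemma hole_mem_IC {n : ℕ} {i j : Fin n} (hij : i ≤ j) (hji : (j : ℕ) ≤ i + 1) :
    hole i j ∈ IC n := by
  constructor
  · intro x₁ x₂ y₁ y₂ h₁ h₂ hx
    rw [hole_apply] at h₁ h₂
    grind
  · intro x y h
    rw [hole_apply] at h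
    grind

/-- A factorization in `IC n` of an element fixing `x` consists of elements fixing `x`. -/
lemma fixed_of_mul_fixed {n : ℕ} {a b : PT n} (ha : a ∈ IC n) (hb : b ∈ IC n) {x : Fin n}
    (h : (a * b) x = some x) : a x = some x ∧ b x = some x := by
  obtain ⟨y, h, h'⟩ := mul_apply_eq_some.1 h
  obtain rfl : y = x := le_antisymm (ha.2 _ _ h) (hb.2 _ _ h')
  exact ⟨h, h'⟩

lemma eq_one_of_mul_eq_one {n : ℕ} {a b : PT n} (ha : a ∈ IC n) (hb : b ∈ IC n)
    (h : a * b = 1) : a = 1 := by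
  ext1 x
  exact (fixed_of_mul_fixed ha hb (by rw [h, one_apply])).1

lemma hole_self_irreducible {n : ℕ} {a b : PT n} (ha : a ∈ IC n) (hb : b ∈ IC n) {i : Fin n}
    (h : a * b = hole i i) : a = hole i i ∨ b = hole i i := by
  have hfix : ∀ x, x ≠ i → a x = some x := fun x hx =>
    (fixed_of_mul_fixed ha hb (by rw [h, hole_apply, if_neg hx, if_neg hx])).1
  cases hi : a i with
  | none =>
    left
    ext1 x
    rw [hole_apply]
    by_cases hx : x = i
    · rw [if_pos hx, hx, hi]
    · rw [if_neg hx, if_neg hx, hfix x hx]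
  | some y =>
    right
    have hy : y = i := by
      by_contra hy
      exact hy (a.inj (hfix y hy) hi)
    have h1 : a = 1 := by
      ext1 x
      by_cases hx : x = i
      · rw [hx, hi, hy, one_apply]
      · rw [hfix x hx, one_apply]
    rwa [h1, one_mul] at h

/-- An element of `IC n` which maps `j` to its predecessor `i` and fixes all points other than
`i` and `j` is the corresponding `hole i j`. -/
lemma eq_hole_of_fixed {n : ℕ} {a : PT n} (ha : a ∈ IC n) {i j : Fin n} (hij : i < j)
    (hj : a j = some i) (hfix : ∀ x, x ≠ i → x ≠ j → a x = some x) : a = hole i j := by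
  have hi : a i = none := by
    cases hi : a i with
    | none => rfl
    | some y =>
      exfalso
      have hyi : y ≤ i := ha.2 _ _ hi
      by_cases hy : y = i
      · exact hij.ne (a.inj (hy ▸ hi) hj)
      · exact hy (a.inj (hfix y hy (hyi.trans_lt hij).ne) hi)
  ext1 x
  rw [hole_apply]
  split_ifs with h₁ h₂
  · rw [h₁, hi]
  · rw [h₂, hj]
  · exact hfix x h₁ h₂

lemma hole_irreducible {n : ℕ} {a b : PT n} (ha : a ∈ IC n) (hb : b ∈ IC n) {i j : Fin n}
    (hij : (j : ℕ) = i + 1) (h : a * b = hole i j) : a = hole i j ∨ b = hole i j := by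
  have hlt : i < j := by rw [Fin.lt_def]; omega
  have hfix : ∀ x, x ≠ i → x ≠ j → a x = some x ∧ b x = some x := fun x hi hj =>
    fixed_of_mul_fixed ha hb (by rw [h, hole_apply, if_neg hi, if_neg hj])
  have hj : (a * b) j = some i := by rw [h, hole_apply, if_neg hlt.ne', if_pos rfl]
  obtain ⟨y, hay, hby⟩ := mul_apply_eq_some.1 hj
  have h₁ := ha.2 _ _ hay
  have h₂ := hb.2 _ _ hby
  have hy : y = i ∨ y = j := by
    rw [Fin.le_def] at h₁ h₂
    rw [Fin.ext_iff, Fin.ext_iff]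
    omega
  rcases hy with rfl | rfl
  · exact .inl (eq_hole_of_fixed ha hlt hay fun x hi hj => (hfix x hi hj).1)
  · exact .inr (eq_hole_of_fixed hb hlt hby fun x hi hj => (hfix x hi hj).2)

/-- The irreducible elements of `IC (m + 1)`. -/
noncomputable def gen (m : ℕ) : Option (Fin (m + 1) ⊕ Fin m) → PT (m + 1)
  | none => 1
  | some (.inl i) => hole i i
  | some (.inr i) => hole i.castSucc i.succ

lemma gen_mem_IC {m : ℕ} (t) : gen m t ∈ IC (m + 1) := by
  rcases t with _ | i | i
  · exact one_mem_IC _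
  · exact hole_mem_IC le_rfl (by simp)
  · exact hole_mem_IC i.castSucc_lt_succ.le (by simp)

lemma gen_injective (m : ℕ) : Function.Injective (gen m) := by
  have key : ∀ i j k l : Fin (m + 1), i ≤ j → k ≤ l → hole i j = hole k l → i = k ∧ j = l := by
    intro i j k l hij hkl h
    have hik : i = k := by
      have := DFunLike.congr_fun h i
      rw [hole_apply, hole_apply] at this
      grind
    have hj := DFunLike.congr_fun h j
    have hl := DFunLike.congr_fun h l
    rw [hole_apply, hole_apply] at hj hl
    grind
  have key' : ∀ i j : Fin (m + 1), hole i j ≠ 1 := by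
    intro i j h
    have := DFunLike.congr_fun h i
    rw [hole_apply, if_pos rfl, one_apply] at this
    cases this
  rintro (_ | i | i) (_ | j | j) h
  · rfl
  · exact absurd h.symm (key' _ _)
  · exact absurd h.symm (key' _ _)
  · exact absurd h (key' _ _)
  · rw [(key _ _ _ _ le_rfl le_rfl h).1]
  · obtain ⟨h₁, h₂⟩ := key _ _ _ _ le_rfl j.castSucc_lt_succ.le h
    exact absurd (h₁.symm.trans h₂) j.castSucc_lt_succ.ne
  · exact absurd h (key' _ _)
  · obtain ⟨h₁, h₂⟩ := key _ _ _ _ i.castSucc_lt_succ.le le_rfl h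
    exact absurd (h₁.trans h₂.symm) i.castSucc_lt_succ.ne
  · rw [Fin.succ_injective _ (key _ _ _ _ i.castSucc_lt_succ.le j.castSucc_lt_succ.le h).2]

lemma ncard_range_gen (m : ℕ) : (Set.range (gen m)).ncard = 2 * (m + 1) := by
  rw [← Set.image_univ, Set.ncard_image_of_injective _ (gen_injective m), Set.ncard_univ,
    Nat.card_eq_fintype_card]
  simp
  omega

lemma gen_irreducible {m : ℕ} {a b : PT (m + 1)} (ha : a ∈ IC (m + 1)) (hb : b ∈ IC (m + 1)) {t}
    (h : a * b = gen m t) : a = gen m t ∨ b = gen m t := by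
  rcases t with _ | i | i
  · exact .inl (eq_one_of_mul_eq_one ha hb h)
  · exact hole_self_irreducible ha hb h
  · exact hole_irreducible ha hb (by simp) h

/-- Every subset of `IC (m + 1)` generating it contains all the irreducible elements. -/
lemma range_gen_subset {m : ℕ} {A : Set (PT (m + 1))} (hA : A ⊆ IC (m + 1))
    (hcl : (Subsemigroup.closure A : Set (PT (m + 1))) = IC (m + 1)) :
    Set.range (gen m) ⊆ A := by
  have key : ∀ x ∈ Subsemigroup.closure A,
      x ∈ IC (m + 1) ∧ (x ∈ Set.range (gen m) → x ∈ A) := by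
    intro x hx
    induction hx using Subsemigroup.closure_induction with
    | mem x hx => exact ⟨hA hx, fun _ => hx⟩
    | mul a b _ _ iha ihb =>
      refine ⟨IC.mul iha.1 ihb.1, ?_⟩
      rintro ⟨t, ht⟩
      rcases gen_irreducible iha.1 ihb.1 ht.symm with h | h
      · rw [← ht, ← h]
        exact iha.2 ⟨t, h.symm⟩
      · rw [← ht, ← h]
        exact ihb.2 ⟨t, h.symm⟩
  rintro _ ⟨t, rfl⟩
  refine (key _ ?_).2 ⟨t, rfl⟩
  rw [← SetLike.mem_coe, hcl]
  exact gen_mem_IC t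

lemma pid_compl_mem_closure {m : ℕ} (s : Finset (Fin (m + 1))) :
    pid ((s : Set (Fin (m + 1)))ᶜ) ∈ Subsemigroup.closure (Set.range (gen m)) := by
  induction s using Finset.induction_on with
  | empty =>
    have : pid (((∅ : Finset (Fin (m + 1))) : Set (Fin (m + 1)))ᶜ) = gen m none := by
      ext1 x
      simp [pid_apply, gen, one_apply]
    rw [this]
    exact Subsemigroup.subset_closure ⟨_, rfl⟩
  | insert i s _ ih =>
    have : pid (((insert i s : Finset (Fin (m + 1))) : Set (Fin (m + 1)))ᶜ) =
        pid ((s : Set (Fin (m + 1)))ᶜ) * gen m (some (.inl i)) := by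
      ext1 x
      by_cases hx : x ∈ s
      · rw [mul_apply_of_eq_none (by simp [pid_apply, hx])]
        simp [pid_apply, hx]
      · rw [mul_apply_of_eq_some (y := x) (by simp [pid_apply, hx])]
        simp [gen, hole_self, pid_apply, hx]
    rw [this]
    exact Subsemigroup.mul_mem _ ih (Subsemigroup.subset_closure ⟨_, rfl⟩)

lemma swap_mul_apply {n : ℕ} (i j x : Fin n) (a : PT n) :
    ((Equiv.swap i j).toPEquiv * a : PT n) x = a (Equiv.swap i j x) :=
  mul_apply_of_eq_some (Equiv.toPEquiv_apply _ _)

lemma hole_mul_swap_mul {n : ℕ} {a : PT n} {i j : Fin n} (hi : a i = none) :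
    hole i j * ((Equiv.swap i j).toPEquiv * a) = a := by
  ext1 x
  by_cases hx : x = i
  · rw [mul_apply_of_eq_none (by rw [hole_apply, if_pos hx]), hx, hi]
  · by_cases hxj : x = j
    · rw [mul_apply_of_eq_some (y := i) (by rw [hole_apply, if_neg hx, if_pos hxj]),
        swap_mul_apply, Equiv.swap_apply_left, hxj]
    · rw [mul_apply_of_eq_some (y := x) (by rw [hole_apply, if_neg hx, if_neg hxj]),
        swap_mul_apply, Equiv.swap_apply_of_ne_of_ne hx hxj]

lemma swap_mul_mem_IC {n : ℕ} {a : PT n} (ha : a ∈ IC n) {i j y : Fin n}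
    (hij : (j : ℕ) = i + 1) (hi : a i = none) (hj : a j = some y) (hy : y < j) :
    (Equiv.swap i j).toPEquiv * a ∈ IC n := by
  have key : ∀ x z, ((Equiv.swap i j).toPEquiv * a : PT n) x = some z →
      (x = i ∧ z = y) ∨ (x ≠ i ∧ x ≠ j ∧ a x = some z) := by
    intro x z h
    rw [swap_mul_apply, Equiv.swap_apply_def] at h
    grind
  constructor
  · intro x₁ x₂ y₁ y₂ h₁ h₂ hx
    rcases key _ _ h₁ with ⟨rfl, rfl⟩ | ⟨h1, g1, e1⟩ <;>
      rcases key _ _ h₂ with ⟨rfl, rfl⟩ | ⟨h2, g2, e2⟩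
    · exact le_rfl
    · exact ha.1 _ _ _ _ hj e2 (by omega)
    · exact ha.1 _ _ _ _ e1 hj (by omega)
    · exact ha.1 _ _ _ _ e1 e2 hx
  · intro x z h
    rcases key _ _ h with ⟨rfl, rfl⟩ | ⟨_, _, hx⟩
    · omega
    · exact ha.2 _ _ hx

/-- The sum of the (zero-based) points in the domain. -/
noncomputable def domSum {n : ℕ} (a : PT n) : ℕ := ∑ x, if a x = none then 0 else (x : ℕ)

lemma domSum_swap_mul_lt {n : ℕ} {a : PT n} {i j y : Fin n} (hij : i < j) (hi : a i = none)
    (hj : a j = some y) : domSum ((Equiv.swap i j).toPEquiv * a) < domSum a := by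
  have : domSum ((Equiv.swap i j).toPEquiv * a) =
      ∑ x, if a x = none then 0 else ((Equiv.swap i j x : Fin n) : ℕ) := by
    rw [domSum, ← Equiv.sum_comp (Equiv.swap i j)]
    simp only [swap_mul_apply, Equiv.swap_apply_self]
  rw [this, domSum]
  apply Finset.sum_lt_sum
  · intro x _
    rw [Equiv.swap_apply_def]
    split_ifs with h₁ h₂ h₃
    · exact le_rfl
    · exact absurd (h₂ ▸ hi) h₁
    · rw [h₃]
      exact hij.le
    · exact le_rfl
  · refine ⟨j, Finset.mem_univ _, ?_⟩
    rw [if_neg (by simp [hj]), if_neg (by simp [hj]), Equiv.swap_apply_right]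
    exact hij

/-- An element of `IC n` moving some point moves a point whose predecessor lies outside its
domain. -/
lemma exists_moved {n : ℕ} {a : PT n} (ha : a ∈ IC n) (h : ¬ ∀ x y, a x = some y → y = x) :
    ∃ i j y : Fin n, (j : ℕ) = i + 1 ∧ a i = none ∧ a j = some y ∧ y < j := by
  have hex : ∃ k : ℕ, ∃ x y : Fin n, (x : ℕ) = k ∧ a x = some y ∧ y ≠ x := by
    push Not at h
    obtain ⟨x, y, h, h'⟩ := h
    exact ⟨x, x, y, rfl, h, h'⟩
  obtain ⟨j, y, hjk, hj, hne⟩ := Nat.find_spec hex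
  have hy : y < j := lt_of_le_of_ne (ha.2 _ _ hj) hne
  have hij : (j : ℕ) - 1 + 1 = j := by omega
  refine ⟨⟨j - 1, by omega⟩, j, y, hij.symm, ?_, hj, hy⟩
  cases hi : a ⟨j - 1, by omega⟩ with
  | none => rfl
  | some z =>
    exfalso
    have hz : z = ⟨j - 1, by omega⟩ := by
      by_contra hz
      exact Nat.find_min hex (m := j - 1) (by omega) ⟨_, z, rfl, hi, hz⟩
    have hzy : z ≤ y := ha.1 _ _ _ _ hi hj (by rw [Fin.le_def]; simp)
    have : z = y := by
      rw [Fin.le_def, hz] at hzy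
      rw [hz, Fin.ext_iff]
      simp only at hzy ⊢
      omega
    have := congrArg Fin.val (a.inj hi (this ▸ hj))
    simp only at this
    omega

lemma mem_closure_range_gen {m : ℕ} {a : PT (m + 1)} (ha : a ∈ IC (m + 1)) :
    a ∈ Subsemigroup.closure (Set.range (gen m)) := by
  induction hk : domSum a using Nat.strong_induction_on generalizing a with
  | _ k ih =>
  by_cases h : ∀ x y, a x = some y → y = x
  · have : a = pid (((Finset.univ.filter fun x => a x = none : Finset (Fin (m + 1))) :
        Set (Fin (m + 1)))ᶜ) := by
      ext1 x
      rw [pid_apply]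
      cases hx : a x with
      | none => simp [hx]
      | some y => simp [hx, h x y hx]
    rw [this]
    exact pid_compl_mem_closure _
  · obtain ⟨i, j, y, hij, hi, hj, hy⟩ := exists_moved ha h
    have hlt : i < j := by rw [Fin.lt_def]; omega
    rw [← hole_mul_swap_mul (j := j) hi]
    refine Subsemigroup.mul_mem _ (Subsemigroup.subset_closure ?_)
      (ih _ (hk ▸ domSum_swap_mul_lt hlt hi hj) (swap_mul_mem_IC ha hij hi hj hy) rfl)
    refine ⟨some (.inr ⟨i, by omega⟩), ?_⟩
    have : (⟨i, by omega⟩ : Fin m).succ = j := Fin.ext hij.symm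
    rw [gen, this]
    rfl

lemma closure_range_gen (m : ℕ) :
    (Subsemigroup.closure (Set.range (gen m)) : Set (PT (m + 1))) = IC (m + 1) := by
  refine Set.Subset.antisymm (fun x hx => ?_) fun x hx => mem_closure_range_gen hx
  induction hx using Subsemigroup.closure_induction with
  | mem x hx =>
    obtain ⟨t, rfl⟩ := hx
    exact gen_mem_IC t
  | mul a b _ _ iha ihb => exact IC.mul iha ihb

/-- the rank of `IC_n` as a semigroup is `2n`. -/
theorem stmt17 (n : ℕ) (hn : 0 < n) :
    IsLeast
      {k : ℕ | ∃ A : Set (PT n),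
        A ⊆ IC n ∧ (↑(Subsemigroup.closure A) : Set (PT n)) = IC n ∧ A.ncard = k}
      (2 * n) := by
  obtain ⟨m, rfl⟩ := Nat.exists_eq_succ_of_ne_zero hn.ne'
  refine ⟨⟨Set.range (gen m), ?_, closure_range_gen m, ncard_range_gen m⟩, ?_⟩
  · rintro _ ⟨t, rfl⟩
    exact gen_mem_IC t
  · rintro k ⟨A, hA, hcl, rfl⟩
    have hfin : A.Finite :=
      (Set.finite_univ.preimage (DFunLike.coe_injective (F := PT (m + 1))).injOn).subset
        (Set.subset_univ _)
    rw [← ncard_range_gen m]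
    exact Set.ncard_le_ncard (range_gen_subset hA hcl) hfin

end ICCatalan
end

section
/- Let M(n,p) = {α ∈ Q'_n : |im α| ≤ p}, a two-sided ideal (in particular a subsemigroup) of Q'_n. For n ≥ 3 and 1 ≤ p ≤ n−2, the rank of the semigroup M(n,p) equals C(n, p) + (n−2)·C(n−3, p−1), where C denotes the binomial coefficient. -/
open scoped Classical

namespace ICCatalan

/-- The two-sided ideal `M(n,p) = {α ∈ Q'_n : |im α| ≤ p}` of `Q'_n`. -/
def Mnp (n p : ℕ) : Set (PT n) := {α | α ∈ Qp n ∧ height α ≤ p}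

variable {n : ℕ}

lemma pt_ext {f g : PT n} (h : ∀ x y, f x = some y ↔ g x = some y) : f = g :=
  PEquiv.ext fun x => Option.ext fun y => h x y

lemma mul_eq_some {f g : PT n} {x z : Fin n} :
    (f * g) x = some z ↔ ∃ y, f x = some y ∧ g y = some z :=
  PEquiv.trans_eq_some f g x z

lemma symm_eq_some {f : PT n} {x y : Fin n} : f.symm x = some y ↔ f y = some x :=
  PEquiv.eq_some_iff f

lemma pt_inj {f : PT n} {x x' y : Fin n} (h : f x = some y) (h' : f x' = some y) : x = x' :=
  PEquiv.inj f h h'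

lemma finite_PT : Finite (PT n) :=
  Finite.of_injective (fun f : PT n => (f : Fin n → Option (Fin n))) DFunLike.coe_injective

/-- The partial injection whose graph is a given bi-unique relation. -/
noncomputable def ofRel (R : Fin n → Fin n → Prop)
    (h₁ : ∀ x y y', R x y → R x y' → y = y') (h₂ : ∀ x x' y, R x y → R x' y → x = x') : PT n where
  toFun x := if h : ∃ y, R x y then some h.choose else none
  invFun y := if h : ∃ x, R x y then some h.choose else none
  inv x y := by
    have e₁ : ∀ a b, a ∈ (if h : ∃ x, R x b then some h.choose else none) ↔ R a b := by
      intro a b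
      split_ifs with h
      · simp only [Option.mem_def, Option.some.injEq]
        exact ⟨fun e => e ▸ h.choose_spec, fun e => h₂ _ _ _ h.choose_spec e⟩
      · simpa using fun e => h ⟨a, e⟩
    have e₂ : ∀ a b, b ∈ (if h : ∃ y, R a y then some h.choose else none) ↔ R a b := by
      intro a b
      split_ifs with h
      · simp only [Option.mem_def, Option.some.injEq]
        exact ⟨fun e => e ▸ h.choose_spec, fun e => h₁ _ _ _ h.choose_spec e⟩
      · simpa using fun e => h ⟨b, e⟩
    exact (e₁ x y).trans (e₂ x y).symm

lemma ofRel_eq_some {R : Fin n → Fin n → Prop} {h₁ h₂} {x y : Fin n} :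
    ofRel R h₁ h₂ x = some y ↔ R x y := by
  change (if h : ∃ y, R x y then some h.choose else none) = some y ↔ R x y
  split_ifs with h
  · simp only [Option.some.injEq]
    exact ⟨fun e => e ▸ h.choose_spec, fun e => h₁ _ _ _ h.choose_spec e⟩
  · simpa using fun e => h ⟨y, e⟩

/-- The domain of a partial transformation, as a finset. -/
noncomputable def domF (f : PT n) : Finset (Fin n) := Finset.univ.filter fun x => ∃ y, f x = some y

lemma mem_domF {f : PT n} {x : Fin n} : x ∈ domF f ↔ ∃ y, f x = some y := by simp [domF]

lemma height_eq_card_domF (f : PT n) : height f = (domF f).card := by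
  rw [height, ← Set.ncard_coe_finset]
  symm
  refine Set.ncard_congr (fun x hx => (mem_domF.1 hx).choose) ?_ ?_ ?_
  · intro x hx
    exact ⟨x, (mem_domF.1 hx).choose_spec⟩
  · intro x x' hx hx' e
    have h := (mem_domF.1 hx).choose_spec
    have h' := (mem_domF.1 hx').choose_spec
    rw [← e] at h'
    exact pt_inj h h'
  · rintro y ⟨x, hx⟩
    have hm : x ∈ domF f := mem_domF.2 ⟨y, hx⟩
    refine ⟨x, hm, ?_⟩
    have h := (mem_domF.1 hm).choose_spec
    exact Option.some.inj (h.symm.trans hx)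

lemma eq_of_extends {f g : PT n} (h : ∀ x y, f x = some y → g x = some y)
    (hc : height g ≤ height f) : g = f := by
  have hs : pim f ⊆ pim g := fun y ⟨x, hx⟩ => ⟨x, h x y hx⟩
  have he : pim f = pim g := Set.eq_of_subset_of_ncard_le hs hc
  refine pt_ext fun x y => ⟨fun hg => ?_, h x y⟩
  have : y ∈ pim f := he ▸ ⟨x, hg⟩
  obtain ⟨x', hx'⟩ := this
  rw [pt_inj hg (h _ _ hx')]
  exact hx'

/-- `b` lies in the initial run of `B`, i.e. the whole interval below `b` is contained in `B`. -/
def InRun (B : Finset (Fin n)) (b : Fin n) : Prop := ∀ c ≤ b, c ∈ B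

/-- The partial injection with image `B` that moves the initial run of `B` down by one and
fixes everything else. -/
noncomputable def runShift (B : Finset (Fin n)) : PT n :=
  ofRel (fun x y => y ∈ B ∧ ((x = y ∧ ¬ InRun B y) ∨ ((x : ℕ) = y + 1 ∧ InRun B y)))
    (by
      have key : ∀ x y : Fin n, x ∈ B → ¬ InRun B x → (x : ℕ) = y + 1 → ¬ InRun B y := by
        intro x y hx hn e hy
        refine hn fun c hc => ?_
        rcases eq_or_lt_of_le hc with rfl | hlt
        · exact hx
        · exact hy c (by rw [Fin.le_def]; rw [Fin.lt_def] at hlt; omega)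
      rintro x y y' ⟨h1, ⟨rfl, h2⟩ | ⟨h2, h3⟩⟩ ⟨h1', ⟨rfl, h2'⟩ | ⟨h2', h3'⟩⟩
      · rfl
      · exact absurd h3' (key _ _ h1 h2 h2')
      · exact absurd h3 (key _ _ h1' h2' h2)
      · apply Fin.ext; omega)
    (by
      rintro x x' y ⟨h1, ⟨rfl, h2⟩ | ⟨h2, h3⟩⟩ ⟨h1', ⟨rfl, h2'⟩ | ⟨h2', h3'⟩⟩
      · rfl
      · exact absurd h3' h2
      · exact absurd h3 h2'
      · apply Fin.ext; omega)

lemma runShift_eq_some {B : Finset (Fin n)} {x y : Fin n} :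
    runShift B x = some y ↔
      y ∈ B ∧ ((x = y ∧ ¬ InRun B y) ∨ ((x : ℕ) = y + 1 ∧ InRun B y)) := ofRel_eq_some

lemma InRun.mono {B : Finset (Fin n)} {b c : Fin n} (h : InRun B b) (hc : c ≤ b) : InRun B c :=
  fun d hd => h d (hd.trans hc)

lemma not_inRun {B : Finset (Fin n)} (h : ∀ x ∈ B, (x : ℕ) ≠ 0) (b : Fin n) : ¬ InRun B b := by
  intro hb
  have h0 : 0 < n := b.pos
  exact h ⟨0, h0⟩ (hb _ (by simp [Fin.le_def])) rfl

lemma runShift_eq_some_of_zero {B : Finset (Fin n)} (h : ∀ x ∈ B, (x : ℕ) ≠ 0) {x y : Fin n} :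
    runShift B x = some y ↔ x = y ∧ y ∈ B := by
  rw [runShift_eq_some]
  have := not_inRun h y
  tauto

lemma runShift_zero {B : Finset (Fin n)} {x y : Fin n} (h : runShift B x = some y) :
    (x : ℕ) ≠ 0 := by
  rw [runShift_eq_some] at h
  rcases h with ⟨hy, ⟨rfl, hr⟩ | ⟨e, -⟩⟩
  · intro h0
    refine hr fun c hc => ?_
    have : c = x := by apply Fin.ext; rw [Fin.le_def] at hc; omega
    rwa [this]
  · omega

lemma runShift_surj {B : Finset (Fin n)} (hB : B.card < n) {b : Fin n} (hb : b ∈ B) :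
    ∃ x, runShift B x = some b := by
  by_cases hr : InRun B b
  · have hlt : (b : ℕ) + 1 < n := by
      by_contra hge
      have : B = Finset.univ := by
        ext c
        simp only [Finset.mem_univ, iff_true]
        exact hr c (by rw [Fin.le_def]; omega)
      rw [this] at hB
      simp at hB
    exact ⟨⟨b + 1, hlt⟩, runShift_eq_some.2 ⟨hb, Or.inr ⟨rfl, hr⟩⟩⟩
  · exact ⟨b, runShift_eq_some.2 ⟨hb, Or.inl ⟨rfl, hr⟩⟩⟩

lemma pim_runShift {B : Finset (Fin n)} (hB : B.card < n) : pim (runShift B) = ↑B := by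
  ext b
  exact ⟨fun ⟨x, hx⟩ => (runShift_eq_some.1 hx).1, fun hb => runShift_surj hB hb⟩

lemma height_runShift {B : Finset (Fin n)} (hB : B.card < n) : height (runShift B) = B.card := by
  rw [height, pim_runShift hB, Set.ncard_coe_finset]

lemma runShift_mem_Qp (B : Finset (Fin n)) : runShift B ∈ Qp n := by
  refine ⟨⟨?_, ?_⟩, ?_⟩
  · intro x₁ x₂ y₁ y₂ h₁ h₂ hx
    by_contra hy
    rw [not_le] at hy
    have hm : InRun B y₁ → InRun B y₂ := fun h => h.mono hy.le
    rw [runShift_eq_some] at h₁ h₂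
    rw [Fin.lt_def] at hy
    rw [Fin.le_def] at hx
    rcases h₁ with ⟨h4, ⟨rfl, h1⟩ | ⟨e1, h1⟩⟩ <;> rcases h₂ with ⟨-, ⟨rfl, h2⟩ | ⟨e2, h2⟩⟩
    · omega
    · refine h1 fun c hc => ?_
      rcases eq_or_lt_of_le hc with rfl | hlt
      · exact h4
      · exact h2 c (by rw [Fin.le_def]; rw [Fin.lt_def] at hlt; omega)
    · exact h2 (hm h1)
    · omega
  · intro x y h
    rw [runShift_eq_some] at h
    rw [Fin.le_def]
    rcases h with ⟨-, ⟨rfl, -⟩ | ⟨e, -⟩⟩ <;> omega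
  · intro x hx
    by_contra hne
    obtain ⟨y, hy⟩ := Option.ne_none_iff_exists'.1 hne
    exact runShift_zero hy hx

/-- The partial injection sending `a` to `a - 1` and fixing `A` pointwise (points of `A` that
clash with `a` or `a - 1` are discarded). -/
noncomputable def step (a : Fin n) (A : Finset (Fin n)) : PT n :=
  ofRel (fun x y => (x = a ∧ (y : ℕ) + 1 = a) ∨ (x = y ∧ x ∈ A ∧ x ≠ a ∧ (x : ℕ) + 1 ≠ a))
    (by
      rintro x y y' (⟨h1, h2⟩ | ⟨h1, h2, h3, h4⟩) (⟨h1', h2'⟩ | ⟨h1', h2', h3', h4'⟩)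
      · apply Fin.ext; omega
      · exact absurd h1 h3'
      · exact absurd h1' h3
      · exact h1.symm.trans h1')
    (by
      rintro x x' y (⟨h1, h2⟩ | ⟨h1, h2, h3, h4⟩) (⟨h1', h2'⟩ | ⟨h1', h2', h3', h4'⟩)
      · exact h1.trans h1'.symm
      · exact absurd (h1' ▸ h2) h4'
      · exact absurd (h1 ▸ h2') h4
      · exact h1.trans h1'.symm)

/-- `A` avoids `0`, `a - 1` and `a`. -/
def Avoids (a : Fin n) (A : Finset (Fin n)) : Prop :=
  ∀ x ∈ A, (x : ℕ) ≠ 0 ∧ x ≠ a ∧ (x : ℕ) + 1 ≠ a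

lemma step_eq_some {a : Fin n} {A : Finset (Fin n)} (hA : Avoids a A) {x y : Fin n} :
    step a A x = some y ↔ (x = a ∧ (y : ℕ) + 1 = a) ∨ (x = y ∧ x ∈ A) := by
  rw [step, ofRel_eq_some]
  constructor
  · rintro (h | ⟨h1, h2, -⟩)
    · exact Or.inl h
    · exact Or.inr ⟨h1, h2⟩
  · rintro (h | ⟨h1, h2⟩)
    · exact Or.inl h
    · exact Or.inr ⟨h1, h2, (hA x h2).2⟩

lemma step_self {a b : Fin n} {A : Finset (Fin n)} (hA : Avoids a A) (hb : (b : ℕ) + 1 = a) :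
    step a A a = some b := (step_eq_some hA).2 (Or.inl ⟨rfl, hb⟩)

lemma exists_pred {a : Fin n} (ha : 2 ≤ (a : ℕ)) : ∃ b : Fin n, (b : ℕ) + 1 = a :=
  ⟨⟨a - 1, by omega⟩, by simp; omega⟩

lemma domF_step {a : Fin n} {A : Finset (Fin n)} (hA : Avoids a A) (ha : 2 ≤ (a : ℕ)) :
    domF (step a A) = insert a A := by
  ext x
  simp only [mem_domF, step_eq_some hA, Finset.mem_insert]
  obtain ⟨b, hb⟩ := exists_pred ha
  constructor
  · rintro ⟨y, ⟨h, -⟩ | ⟨-, h⟩⟩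
    · exact Or.inl h
    · exact Or.inr h
  · rintro (h | h)
    · exact ⟨b, Or.inl ⟨h, hb⟩⟩
    · exact ⟨x, Or.inr ⟨rfl, h⟩⟩

lemma height_step {a : Fin n} {A : Finset (Fin n)} (hA : Avoids a A) (ha : 2 ≤ (a : ℕ)) :
    height (step a A) = A.card + 1 := by
  rw [height_eq_card_domF, domF_step hA ha, Finset.card_insert_of_notMem]
  exact fun h => (hA a h).2.1 rfl

lemma step_mem_Qp {a : Fin n} {A : Finset (Fin n)} (hA : Avoids a A) (ha : 2 ≤ (a : ℕ)) :
    step a A ∈ Qp n := by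
  refine ⟨⟨?_, ?_⟩, ?_⟩
  · intro x₁ x₂ y₁ y₂ h₁ h₂ hx
    rw [step_eq_some hA] at h₁ h₂
    rw [Fin.le_def] at hx ⊢
    rcases h₁ with ⟨rfl, h1⟩ | ⟨rfl, h1⟩ <;> rcases h₂ with ⟨rfl, h2⟩ | ⟨rfl, h2⟩
    · omega
    · omega
    · have := (hA _ h1).2.1
      have : (x₁ : ℕ) ≠ x₂ := fun h => this (Fin.ext h)
      omega
    · omega
  · intro x y h
    rw [step_eq_some hA] at h
    rw [Fin.le_def]
    rcases h with ⟨rfl, h⟩ | ⟨rfl, h⟩ <;> omega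
  · intro x hx
    by_contra hne
    obtain ⟨y, hy⟩ := Option.ne_none_iff_exists'.1 hne
    rw [step_eq_some hA] at hy
    rcases hy with ⟨rfl, h⟩ | ⟨rfl, h⟩
    · omega
    · exact (hA _ h).1 hx

lemma Qp_ne_zero {f : PT n} (hf : f ∈ Qp n) {x y : Fin n} (h : f x = some y) : (x : ℕ) ≠ 0 := by
  intro h0
  rw [hf.2 x h0] at h
  cases h

/-- The irreducible elements of height `p`. -/
def gens (n p : ℕ) : Set (PT n) :=
  {f | ∃ B : Finset (Fin n), B.card = p ∧ runShift B = f} ∪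
  {f | ∃ (a : Fin n) (A : Finset (Fin n)),
    2 ≤ (a : ℕ) ∧ Avoids a A ∧ A.card + 1 = p ∧ step a A = f}

lemma gens_subset {p : ℕ} (hp : p < n) : gens n p ⊆ Mnp n p := by
  rintro f (⟨B, hB, rfl⟩ | ⟨a, A, ha, hA, hc, rfl⟩)
  · exact ⟨runShift_mem_Qp B, by rw [height_runShift (by omega), hB]⟩
  · exact ⟨step_mem_Qp hA ha, by rw [height_step hA ha, hc]⟩

lemma mul_mem_Mnp {p : ℕ} {f g : PT n} (hf : f ∈ Mnp n p) (hg : g ∈ Mnp n p) :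
    f * g ∈ Mnp n p := by
  refine ⟨⟨⟨?_, ?_⟩, ?_⟩, ?_⟩
  · intro x₁ x₂ y₁ y₂ h₁ h₂ hx
    obtain ⟨z₁, h1, h1'⟩ := mul_eq_some.1 h₁
    obtain ⟨z₂, h2, h2'⟩ := mul_eq_some.1 h₂
    exact hg.1.1.1 _ _ _ _ h1' h2' (hf.1.1.1 _ _ _ _ h1 h2 hx)
  · intro x y h
    obtain ⟨z, h1, h2⟩ := mul_eq_some.1 h
    exact (hg.1.1.2 _ _ h2).trans (hf.1.1.2 _ _ h1)
  · intro x hx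
    by_contra hne
    obtain ⟨y, hy⟩ := Option.ne_none_iff_exists'.1 hne
    obtain ⟨z, h1, -⟩ := mul_eq_some.1 hy
    exact Qp_ne_zero hf.1 h1 hx
  · refine le_trans (Set.ncard_le_ncard ?_) hg.2
    rintro y ⟨x, hx⟩
    obtain ⟨z, -, h2⟩ := mul_eq_some.1 hx
    exact ⟨z, h2⟩

/-- Elements of `S` which occur as a factor in each of their binary factorizations in `S`. -/
def IsIrred (S : Set (PT n)) (f : PT n) : Prop :=
  ∀ g ∈ S, ∀ h ∈ S, g * h = f → g = f ∨ h = f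

lemma mem_of_isIrred {p : ℕ} {A : Set (PT n)}
    (hA : (↑(Subsemigroup.closure A) : Set (PT n)) = Mnp n p) {f : PT n} (hf : f ∈ Mnp n p)
    (hi : IsIrred (Mnp n p) f) : f ∈ A := by
  by_contra hfA
  let T : Subsemigroup (PT n) :=
    { carrier := Mnp n p \ {f}
      mul_mem' := by
        rintro g h ⟨hg, hg'⟩ ⟨hh, hh'⟩
        refine ⟨mul_mem_Mnp hg hh, fun e => ?_⟩
        rcases hi g hg h hh e with e | e
        · exact hg' e
        · exact hh' e }
  have hle : Subsemigroup.closure A ≤ T := by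
    rw [Subsemigroup.closure_le]
    intro g hg
    refine ⟨hA ▸ Subsemigroup.subset_closure hg, fun e => hfA ?_⟩
    rw [Set.mem_singleton_iff] at e
    rwa [← e]
  have hfc : f ∈ Subsemigroup.closure A := by
    rw [← SetLike.mem_coe, hA]; exact hf
  exact (hle hfc).2 rfl

lemma isIrred_runShift {p : ℕ} (hp : p < n) {B : Finset (Fin n)} (hB : B.card = p) :
    IsIrred (Mnp n p) (runShift B) := by
  intro g hg h hh e
  right
  have key : ∀ k : ℕ, ∀ x y : Fin n, (y : ℕ) = k → runShift B x = some y → g x = some x := by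
    intro k
    induction k with
    | zero =>
      intro x y hk hxy
      have hm : (g * h) x = some y := e ▸ hxy
      obtain ⟨z, h1, h2⟩ := mul_eq_some.1 hm
      have hz := Qp_ne_zero hh.1 h2
      have hzx := hg.1.1.2 _ _ h1
      have hyz := hh.1.1.2 _ _ h2
      rw [runShift_eq_some] at hxy
      rw [Fin.le_def] at hzx hyz
      have : z = x := by
        rcases hxy with ⟨-, ⟨rfl, -⟩ | ⟨hx, -⟩⟩ <;> apply Fin.ext <;> omega
      rwa [this] at h1
    | succ k ih =>
      intro x y hk hxy
      have hm : (g * h) x = some y := e ▸ hxy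
      obtain ⟨z, h1, h2⟩ := mul_eq_some.1 hm
      have hzx := hg.1.1.2 _ _ h1
      have hyz := hh.1.1.2 _ _ h2
      rw [runShift_eq_some] at hxy
      rw [Fin.le_def] at hzx hyz
      have : z = x := by
        rcases hxy with ⟨-, ⟨rfl, -⟩ | ⟨hx, hr⟩⟩
        · apply Fin.ext; omega
        · by_contra hne
          have hne' : (z : ℕ) ≠ x := fun h => hne (Fin.ext h)
          have hzy : z = y := by apply Fin.ext; omega
          subst hzy
          have hlt : k < n := by omega
          have hle : (⟨k, hlt⟩ : Fin n) ≤ z := by rw [Fin.le_def]; simp; omega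
          have hr' : runShift B z = some ⟨k, hlt⟩ :=
            runShift_eq_some.2 ⟨hr _ hle, Or.inr ⟨by simp; omega, hr.mono hle⟩⟩
          exact hne (pt_inj (ih _ _ rfl hr') h1)
      rwa [this] at h1
  apply eq_of_extends
  · intro x y hxy
    have hm : (g * h) x = some y := e ▸ hxy
    obtain ⟨z, h1, h2⟩ := mul_eq_some.1 hm
    rw [key _ x y rfl hxy] at h1
    cases h1
    exact h2
  · rw [height_runShift (by omega), hB]
    exact hh.2

lemma isIrred_step {p : ℕ} {a : Fin n} {A : Finset (Fin n)} (ha : 2 ≤ (a : ℕ))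
    (hA : Avoids a A) (hc : A.card + 1 = p) : IsIrred (Mnp n p) (step a A) := by
  intro g hg h hh e
  have hfac : ∀ x y, step a A x = some y →
      ∃ z, g x = some z ∧ h z = some y ∧ y ≤ z ∧ z ≤ x := by
    intro x y hxy
    have hm : (g * h) x = some y := e ▸ hxy
    obtain ⟨z, h1, h2⟩ := mul_eq_some.1 hm
    exact ⟨z, h1, h2, hh.1.1.2 _ _ h2, hg.1.1.2 _ _ h1⟩
  have hfix : ∀ x ∈ A, g x = some x ∧ h x = some x := by
    intro x hx
    obtain ⟨z, h1, h2, h3, h4⟩ := hfac x x ((step_eq_some hA).2 (Or.inr ⟨rfl, hx⟩))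
    rw [le_antisymm h4 h3] at h1 h2
    exact ⟨h1, h2⟩
  obtain ⟨b, hb⟩ := exists_pred ha
  obtain ⟨z, h1, h2, h3, h4⟩ := hfac a b (step_self hA hb)
  rw [Fin.le_def] at h3 h4
  have hht : height (step a A) = p := by rw [height_step hA ha, hc]
  by_cases hz : z = a
  · right
    subst hz
    apply eq_of_extends _ (hht ▸ hh.2)
    intro x y hxy
    rcases (step_eq_some hA).1 hxy with ⟨rfl, hy⟩ | ⟨rfl, hx⟩
    · rwa [show y = b by apply Fin.ext; omega]
    · exact (hfix x hx).2
  · left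
    have hne' : (z : ℕ) ≠ a := fun h => hz (Fin.ext h)
    apply eq_of_extends _ (hht ▸ hg.2)
    intro x y hxy
    rcases (step_eq_some hA).1 hxy with ⟨rfl, hy⟩ | ⟨rfl, hx⟩
    · rwa [show y = z by apply Fin.ext; omega]
    · exact (hfix x hx).1

lemma isIrred_of_mem_gens {p : ℕ} (hp : p < n) {f : PT n} (hf : f ∈ gens n p) :
    IsIrred (Mnp n p) f := by
  rcases hf with ⟨B, hB, rfl⟩ | ⟨a, A, ha, hA, hc, rfl⟩
  · exact isIrred_runShift hp hB
  · exact isIrred_step ha hA hc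

lemma exists_notMem_of_card_lt {s : Finset (Fin n)} (h : s.card < n) : ∃ x, x ∉ s := by
  by_contra! hs
  rw [Finset.eq_univ_of_forall hs] at h
  simp at h

lemma runShift_mul_extension {A : Finset (Fin n)} (hA : ∀ x ∈ A, (x : ℕ) ≠ 0) {f g : PT n}
    (hd : domF f = A) (h : ∀ x y, f x = some y → g x = some y) : runShift A * g = f := by
  refine pt_ext fun x y => ?_
  simp only [mul_eq_some, runShift_eq_some_of_zero hA]
  constructor
  · rintro ⟨z, ⟨rfl, hx⟩, hg⟩
    rw [← hd, mem_domF] at hx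
    obtain ⟨w, hw⟩ := hx
    have := h _ _ hw
    rw [hg] at this
    cases this
    exact hw
  · intro hf
    exact ⟨x, ⟨rfl, hd ▸ mem_domF.2 ⟨y, hf⟩⟩, h _ _ hf⟩

lemma runShift_mem_closure_of_zero {p : ℕ} (hp : p + 2 ≤ n) (k : ℕ) :
    ∀ A : Finset (Fin n), (∀ x ∈ A, (x : ℕ) ≠ 0) → A.card + k = p →
      runShift A ∈ Subsemigroup.closure (gens n p) := by
  induction k with
  | zero => exact fun A _ hc => Subsemigroup.subset_closure (Or.inl ⟨A, hc, rfl⟩)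
  | succ k ih =>
    intro A hA hc
    let o : Fin n := ⟨0, by omega⟩
    obtain ⟨x, hx⟩ := exists_notMem_of_card_lt (s := insert o A)
      (by have := Finset.card_insert_le o A; omega)
    obtain ⟨y, hy⟩ := exists_notMem_of_card_lt (s := insert x (insert o A))
      (by have := Finset.card_insert_le o A
          have := Finset.card_insert_le x (insert o A); omega)
    simp only [Finset.mem_insert, not_or] at hx hy
    have hne : ∀ z : Fin n, z ≠ o → (z : ℕ) ≠ 0 := fun z hz h => hz (Fin.ext h)
    have hins : ∀ z : Fin n, z ≠ o → ∀ w ∈ insert z A, (w : ℕ) ≠ 0 := by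
      intro z hz w hw
      rcases Finset.mem_insert.1 hw with rfl | hw
      · exact hne _ hz
      · exact hA w hw
    have e : runShift A = runShift (insert x A) * runShift (insert y A) := by
      refine pt_ext fun u v => ?_
      simp only [mul_eq_some, runShift_eq_some_of_zero hA, runShift_eq_some_of_zero (hins x hx.1),
        runShift_eq_some_of_zero (hins y hy.2.1), Finset.mem_insert]
      constructor
      · rintro ⟨rfl, hu⟩
        exact ⟨u, ⟨rfl, Or.inr hu⟩, rfl, Or.inr hu⟩
      · rintro ⟨z, ⟨rfl, h1⟩, rfl, h2⟩
        refine ⟨rfl, ?_⟩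
        rcases h1 with rfl | h1
        · rcases h2 with rfl | h2
          · exact absurd rfl hy.1
          · exact h2
        · exact h1
    rw [e]
    refine Subsemigroup.mul_mem _ (ih _ (hins x hx.1) ?_) (ih _ (hins y hy.2.1) ?_)
    · rw [Finset.card_insert_of_notMem hx.2]; omega
    · rw [Finset.card_insert_of_notMem hy.2.2]; omega

lemma runShift_insert_extends {B : Finset (Fin n)} {x : Fin n} (hx0 : (x : ℕ) ≠ 0)
    (hx : x ∉ domF (runShift B)) :
    x ∉ B ∧ ∀ u v, runShift B u = some v → runShift (insert x B) u = some v := by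
  have hpred : ∀ c : Fin n, (c : ℕ) + 1 = x → ¬ InRun B c := fun c hc hr =>
    hx (mem_domF.2 ⟨c, runShift_eq_some.2 ⟨hr c le_rfl, Or.inr ⟨hc.symm, hr⟩⟩⟩)
  have hpx : (⟨x - 1, by omega⟩ : Fin n).val + 1 = x := by simp; omega
  have hxB : x ∉ B := by
    intro hxB
    by_cases hr : InRun B x
    · exact hpred _ hpx (hr.mono (by rw [Fin.le_def]; simp))
    · exact hx (mem_domF.2 ⟨x, runShift_eq_some.2 ⟨hxB, Or.inl ⟨rfl, hr⟩⟩⟩)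
  have hrun : ∀ b, InRun (insert x B) b ↔ InRun B b := by
    intro b
    constructor
    · intro h
      have hbx : b < x := by
        by_contra hge
        rw [not_lt] at hge
        refine hpred _ hpx fun c hc => ?_
        rw [Fin.le_def] at hc hge
        simp only at hc
        have := h c (by rw [Fin.le_def]; omega)
        rcases Finset.mem_insert.1 this with rfl | h'
        · omega
        · exact h'
      intro c hc
      rcases Finset.mem_insert.1 (h c hc) with rfl | h'
      · exact absurd hbx (not_lt.2 hc)
      · exact h'
    · exact fun h c hc => Finset.mem_insert_of_mem (h c hc)
  refine ⟨hxB, fun u v huv => ?_⟩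
  rw [runShift_eq_some] at huv ⊢
  rw [hrun]
  exact ⟨Finset.mem_insert_of_mem huv.1, huv.2⟩

lemma runShift_mem_closure {p : ℕ} (hp : p + 2 ≤ n) (k : ℕ) :
    ∀ B : Finset (Fin n), B.card + k = p →
      runShift B ∈ Subsemigroup.closure (gens n p) := by
  induction k with
  | zero => exact fun A hc => Subsemigroup.subset_closure (Or.inl ⟨A, hc, rfl⟩)
  | succ k ih =>
    intro B hc
    have hcard : (domF (runShift B)).card = B.card := by
      rw [← height_eq_card_domF, height_runShift (by omega)]
    let o : Fin n := ⟨0, by omega⟩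
    obtain ⟨x, hx⟩ := exists_notMem_of_card_lt (s := insert o (domF (runShift B)))
      (by have := Finset.card_insert_le o (domF (runShift B)); omega)
    simp only [Finset.mem_insert, not_or] at hx
    obtain ⟨hxB, hext⟩ := runShift_insert_extends (fun h => hx.1 (Fin.ext h)) hx.2
    have hd : ∀ y ∈ domF (runShift B), (y : ℕ) ≠ 0 := by
      intro y hy
      obtain ⟨z, hz⟩ := mem_domF.1 hy
      exact runShift_zero hz
    rw [← runShift_mul_extension hd rfl hext]
    refine Subsemigroup.mul_mem _
      (runShift_mem_closure_of_zero hp (k + 1) _ hd (by omega)) (ih _ ?_)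
    rw [Finset.card_insert_of_notMem hxB]; omega

lemma step_mem_closure {p : ℕ} (hp : p + 2 ≤ n) {a : Fin n} (ha : 2 ≤ (a : ℕ)) (k : ℕ) :
    ∀ A : Finset (Fin n), Avoids a A → A.card + 1 + k = p →
      step a A ∈ Subsemigroup.closure (gens n p) := by
  induction k with
  | zero => exact fun A hA hc => Subsemigroup.subset_closure (Or.inr ⟨a, A, ha, hA, hc, rfl⟩)
  | succ k ih =>
    intro A hA hc
    obtain ⟨b, hb⟩ := exists_pred ha
    let o : Fin n := ⟨0, by omega⟩
    obtain ⟨x, hx⟩ := exists_notMem_of_card_lt (s := insert o (insert b (insert a A)))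
      (by have := Finset.card_insert_le a A
          have := Finset.card_insert_le b (insert a A)
          have := Finset.card_insert_le o (insert b (insert a A)); omega)
    simp only [Finset.mem_insert, not_or] at hx
    have hA' : Avoids a (insert x A) := by
      intro y hy
      rcases Finset.mem_insert.1 hy with rfl | hy
      · exact ⟨fun h => hx.1 (Fin.ext h), hx.2.2.1, fun h => hx.2.1 (by apply Fin.ext; omega)⟩
      · exact hA y hy
    have hd0 : ∀ y ∈ insert a A, (y : ℕ) ≠ 0 := by
      intro y hy
      rcases Finset.mem_insert.1 hy with rfl | hy
      · omega
      · exact (hA y hy).1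
    have hext : ∀ u v, step a A u = some v → step a (insert x A) u = some v := by
      intro u v huv
      rw [step_eq_some hA] at huv
      rw [step_eq_some hA']
      exact huv.imp_right fun h => ⟨h.1, Finset.mem_insert_of_mem h.2⟩
    rw [← runShift_mul_extension hd0 (domF_step hA ha) hext]
    have hac : (insert a A).card = A.card + 1 :=
      Finset.card_insert_of_notMem fun h => (hA a h).2.1 rfl
    refine Subsemigroup.mul_mem _
      (runShift_mem_closure_of_zero hp (k + 1) _ hd0 (by omega)) (ih _ hA' ?_)
    rw [Finset.card_insert_of_notMem hx.2.2.2]; omega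

lemma mem_closure_of_zero_notMem_pim {p : ℕ} (hp : p + 2 ≤ n) (w : ℕ) :
    ∀ f : PT n, f ∈ Qp n → (∀ x y, f x = some y → (y : ℕ) ≠ 0) → (domF f).card ≤ p →
      (∑ x ∈ domF f, (x : ℕ)) = w → f ∈ Subsemigroup.closure (gens n p) := by
  induction w using Nat.strong_induction_on with
  | _ w ih =>
  intro f hf h0 hc hw
  have hd0 : ∀ y ∈ domF f, (y : ℕ) ≠ 0 := by
    intro y hy
    obtain ⟨z, hz⟩ := mem_domF.1 hy
    exact Qp_ne_zero hf hz
  by_cases hid : ∀ x y, f x = some y → y = x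
  · have e : f = runShift (domF f) := by
      refine pt_ext fun x y => ?_
      rw [runShift_eq_some_of_zero hd0]
      constructor
      · intro h
        have := hid _ _ h
        subst this
        exact ⟨rfl, mem_domF.2 ⟨_, h⟩⟩
      · rintro ⟨rfl, h⟩
        obtain ⟨z, hz⟩ := mem_domF.1 h
        rwa [hid _ _ hz] at hz
    rw [e]
    exact runShift_mem_closure_of_zero hp (p - (domF f).card) _ hd0 (by omega)
  · push Not at hid
    have hne : (Finset.univ.filter fun x : Fin n => ∃ y, f x = some y ∧ y ≠ x).Nonempty := by
      obtain ⟨x, y, h1, h2⟩ := hid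
      exact ⟨x, by simpa using ⟨y, h1, h2⟩⟩
    obtain ⟨a, ha, hmin⟩ := Finset.exists_min_image _ (fun x => x) hne
    simp only [Finset.mem_filter, Finset.mem_univ, true_and] at ha hmin
    obtain ⟨c, hac, hca⟩ := ha
    have hcle := hf.1.2 _ _ hac
    have hclt : (c : ℕ) < a := by
      rw [Fin.le_def] at hcle
      have : (c : ℕ) ≠ a := fun h => hca (Fin.ext h)
      omega
    have hc0 := h0 _ _ hac
    have ha2 : 2 ≤ (a : ℕ) := by omega
    obtain ⟨b, hb⟩ := exists_pred ha2
    have hbd : b ∉ domF f := by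
      intro hbd
      obtain ⟨z, hz⟩ := mem_domF.1 hbd
      have hzb : z = b := by
        by_contra hzb
        have := hmin b ⟨z, hz, hzb⟩
        rw [Fin.le_def] at this
        omega
      subst hzb
      have h1 := hf.1.1 _ _ _ _ hz hac (by rw [Fin.le_def]; omega)
      rw [Fin.le_def] at h1
      have : c = z := by apply Fin.ext; omega
      subst this
      have := pt_inj hz hac
      subst this
      omega
    have had : a ∈ domF f := mem_domF.2 ⟨c, hac⟩
    have hA : Avoids a ((domF f).erase a) := by
      intro x hx
      rw [Finset.mem_erase] at hx
      refine ⟨hd0 x hx.2, hx.1, fun h => hbd ?_⟩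
      rw [show b = x by apply Fin.ext; omega]
      exact hx.2
    set s := step a ((domF f).erase a) with hs
    have hstep : ∀ x y, s x = some y ↔
        (x = a ∧ (y : ℕ) + 1 = a) ∨ (x = y ∧ x ≠ a ∧ x ∈ domF f) := by
      intro x y
      rw [hs, step_eq_some hA, Finset.mem_erase]
    have hsome : ∀ x y, (s.symm * f : PT n) x = some y ↔
        (x = b ∧ y = c) ∨ (x ≠ a ∧ f x = some y) := by
      intro x y
      simp only [mul_eq_some, symm_eq_some, hstep]
      constructor
      · rintro ⟨z, ⟨rfl, h1⟩ | ⟨rfl, h1, h2⟩, h3⟩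
        · rw [hac] at h3
          cases h3
          exact Or.inl ⟨by apply Fin.ext; omega, rfl⟩
        · exact Or.inr ⟨h1, h3⟩
      · rintro (⟨rfl, rfl⟩ | ⟨h1, h2⟩)
        · exact ⟨a, Or.inl ⟨rfl, hb⟩, hac⟩
        · exact ⟨x, Or.inr ⟨rfl, h1, mem_domF.2 ⟨y, h2⟩⟩, h2⟩
    have hdom : domF (s.symm * f : PT n) = insert b ((domF f).erase a) := by
      ext x
      simp only [mem_domF, hsome, Finset.mem_insert, Finset.mem_erase]
      constructor
      · rintro ⟨y, ⟨h, -⟩ | ⟨h, h'⟩⟩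
        · exact Or.inl h
        · exact Or.inr ⟨h, y, h'⟩
      · rintro (h | ⟨h, y, h'⟩)
        · exact ⟨c, Or.inl ⟨h, rfl⟩⟩
        · exact ⟨y, Or.inr ⟨h, h'⟩⟩
    have hbe : b ∉ (domF f).erase a := fun h => hbd (Finset.mem_of_mem_erase h)
    have hfac : s * (s.symm * f : PT n) = f := by
      refine pt_ext fun x y => ?_
      rw [mul_eq_some]
      simp only [hstep, hsome]
      constructor
      · rintro ⟨z, ⟨rfl, h1⟩ | ⟨rfl, h1, h2⟩, ⟨rfl, rfl⟩ | ⟨h3, h4⟩⟩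
        · exact hac
        · exact absurd (mem_domF.2 ⟨y, show f b = some y by
            rwa [show b = z by apply Fin.ext; omega]⟩) hbd
        · exact absurd h2 hbd
        · exact h4
      · intro h
        by_cases hxa : x = a
        · subst hxa
          rw [hac] at h
          cases h
          exact ⟨b, Or.inl ⟨rfl, hb⟩, Or.inl ⟨rfl, rfl⟩⟩
        · exact ⟨x, Or.inr ⟨rfl, hxa, mem_domF.2 ⟨y, h⟩⟩, Or.inr ⟨hxa, h⟩⟩
    have hce : ((domF f).erase a).card + 1 = (domF f).card := Finset.card_erase_add_one had
    rw [← hfac]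
    refine Subsemigroup.mul_mem _
      (step_mem_closure hp ha2 (p - (domF f).card) _ hA (by omega))
      (ih (∑ x ∈ domF (s.symm * f : PT n), (x : ℕ)) ?_ _ ⟨⟨?_, ?_⟩, ?_⟩ ?_ ?_ rfl)
    · rw [hdom, Finset.sum_insert hbe, ← hw, ← Finset.sum_erase_add _ _ had]
      omega
    · intro x₁ x₂ y₁ y₂ h₁ h₂ hx
      rcases (hsome _ _).1 h₁ with ⟨rfl, rfl⟩ | ⟨h1, h1'⟩ <;>
        rcases (hsome _ _).1 h₂ with ⟨rfl, rfl⟩ | ⟨h2, h2'⟩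
      · exact le_rfl
      · refine hf.1.1 _ _ _ _ hac h2' ?_
        have : x₁ ≠ x₂ := fun h => hbd (h ▸ mem_domF.2 ⟨_, h2'⟩)
        have : (x₁ : ℕ) ≠ x₂ := fun h => this (Fin.ext h)
        rw [Fin.le_def] at hx ⊢
        omega
      · refine hf.1.1 _ _ _ _ h1' hac ?_
        rw [Fin.le_def] at hx ⊢
        omega
      · exact hf.1.1 _ _ _ _ h1' h2' hx
    · intro x y h
      rcases (hsome _ _).1 h with ⟨rfl, rfl⟩ | ⟨-, h⟩
      · rw [Fin.le_def]; omega
      · exact hf.1.2 _ _ h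
    · intro x hx
      by_contra hne
      obtain ⟨y, hy⟩ := Option.ne_none_iff_exists'.1 hne
      rcases (hsome _ _).1 hy with ⟨rfl, rfl⟩ | ⟨-, h⟩
      · omega
      · exact Qp_ne_zero hf h hx
    · intro x y h
      rcases (hsome _ _).1 h with ⟨rfl, rfl⟩ | ⟨-, h⟩
      · exact hc0
      · exact h0 _ _ h
    · rw [hdom, Finset.card_insert_of_notMem hbe]
      omega

lemma lt_of_inRun {f : PT n} (hf : f ∈ Qp n) {B : Finset (Fin n)}
    (hB : ∀ b ∈ B, ∃ x, f x = some b) (k : ℕ) :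
    ∀ x b : Fin n, (b : ℕ) = k → InRun B b → f x = some b → b < x := by
  induction k with
  | zero =>
    intro x b hk _ hx
    have := Qp_ne_zero hf hx
    rw [Fin.lt_def]; omega
  | succ k ih =>
    intro x b hk hr hx
    have hlt : k < n := by omega
    have hle : (⟨k, hlt⟩ : Fin n) ≤ b := by rw [Fin.le_def]; simp; omega
    obtain ⟨x', hx'⟩ := hB _ (hr _ hle)
    have h1 := ih x' _ rfl (hr.mono hle) hx'
    have h2 : x' < x := by
      by_contra hge
      have h3 := hf.1.1 _ _ _ _ hx hx' (not_lt.1 hge)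
      rw [Fin.le_def] at h3
      simp only at h3
      omega
    rw [Fin.lt_def] at *
    simp only at h1
    omega

lemma mem_closure_gens {p : ℕ} (hp : p + 2 ≤ n) {f : PT n} (hf : f ∈ Mnp n p) :
    f ∈ Subsemigroup.closure (gens n p) := by
  obtain ⟨hf, hh⟩ := hf
  set B : Finset (Fin n) := Finset.univ.filter fun y => ∃ x, f x = some y with hBdef
  have hmB : ∀ b, b ∈ B ↔ ∃ x, f x = some b := by simp [hBdef]
  have hBc : B.card ≤ p := by
    have : pim f = ↑B := by ext b; simp [hmB, pim]
    rwa [height, this, Set.ncard_coe_finset] at hh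
  have hfac : (f * (runShift B).symm : PT n) * runShift B = f := by
    refine pt_ext fun x y => ?_
    simp only [mul_eq_some, symm_eq_some]
    constructor
    · rintro ⟨z, ⟨w, h1, h2⟩, h3⟩
      rw [h2] at h3
      cases h3
      exact h1
    · intro h
      obtain ⟨z, hz⟩ := runShift_surj (B := B) (by omega) ((hmB y).2 ⟨x, h⟩)
      exact ⟨z, ⟨y, h, hz⟩, hz⟩
  have hsome : ∀ x z, (f * (runShift B).symm : PT n) x = some z →
      ∃ y, f x = some y ∧ runShift B z = some y := by
    intro x z h
    simpa only [mul_eq_some, symm_eq_some] using h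
  rw [← hfac]
  refine Subsemigroup.mul_mem _ (mem_closure_of_zero_notMem_pim hp _ _ ⟨⟨?_, ?_⟩, ?_⟩ ?_ ?_ rfl)
    (runShift_mem_closure hp (p - B.card) _ (by omega))
  · intro x₁ x₂ z₁ z₂ h₁ h₂ hx
    obtain ⟨y₁, h1, h1'⟩ := hsome _ _ h₁
    obtain ⟨y₂, h2, h2'⟩ := hsome _ _ h₂
    by_contra hz
    rw [not_le] at hz
    have h3 := (runShift_mem_Qp B).1.1 _ _ _ _ h2' h1' hz.le
    have h4 := hf.1.1 _ _ _ _ h1 h2 hx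
    have h5 := le_antisymm h3 h4
    subst h5
    exact hz.ne (pt_inj h2' h1')
  · intro x z h
    obtain ⟨y, h1, h2⟩ := hsome _ _ h
    rcases runShift_eq_some.1 h2 with ⟨-, ⟨rfl, -⟩ | ⟨e, hr⟩⟩
    · exact hf.1.2 _ _ h1
    · have := lt_of_inRun hf (fun b hb => (hmB b).1 hb) _ x y rfl hr h1
      rw [Fin.lt_def] at this
      rw [Fin.le_def]
      omega
  · intro x hx
    by_contra hne
    obtain ⟨z, hz⟩ := Option.ne_none_iff_exists'.1 hne
    obtain ⟨y, h1, -⟩ := hsome _ _ hz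
    exact Qp_ne_zero hf h1 hx
  · intro x z h
    obtain ⟨y, -, h2⟩ := hsome _ _ h
    exact runShift_zero h2
  · rw [height_eq_card_domF] at hh
    refine le_trans (Finset.card_le_card fun x hx => ?_) hh
    obtain ⟨z, hz⟩ := mem_domF.1 hx
    obtain ⟨y, h1, -⟩ := hsome _ _ hz
    exact mem_domF.2 ⟨y, h1⟩

lemma closure_gens {p : ℕ} (hp : p + 2 ≤ n) :
    (↑(Subsemigroup.closure (gens n p)) : Set (PT n)) = Mnp n p := by
  refine Set.Subset.antisymm ?_ fun f hf => mem_closure_gens hp hf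
  let T : Subsemigroup (PT n) := { carrier := Mnp n p, mul_mem' := mul_mem_Mnp }
  exact (Subsemigroup.closure_le (S := T)).2 (gens_subset (by omega))

lemma ncard_runShift {p : ℕ} (hp : p < n) :
    {f : PT n | ∃ B : Finset (Fin n), B.card = p ∧ runShift B = f}.ncard = n.choose p := by
  have e : {f : PT n | ∃ B : Finset (Fin n), B.card = p ∧ runShift B = f} =
      runShift '' (↑(Finset.powersetCard p (Finset.univ : Finset (Fin n)))) := by
    ext f
    simp
  rw [e, Set.InjOn.ncard_image, Set.ncard_coe_finset, Finset.card_powersetCard,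
    Finset.card_univ, Fintype.card_fin]
  intro B hB B' hB' h
  rw [Finset.mem_coe, Finset.mem_powersetCard] at hB hB'
  have := congrArg pim h
  rw [pim_runShift (by omega), pim_runShift (by omega)] at this
  exact_mod_cast this

lemma ncard_step {p : ℕ} (hn : 3 ≤ n) (hp : 1 ≤ p) :
    {f : PT n | ∃ (a : Fin n) (A : Finset (Fin n)),
      2 ≤ (a : ℕ) ∧ Avoids a A ∧ A.card + 1 = p ∧ step a A = f}.ncard =
      (n - 2) * (n - 3).choose (p - 1) := by
  let pts : Fin n → Finset (Fin n) := fun a =>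
    Finset.univ.filter fun x => (x : ℕ) ≠ 0 ∧ x ≠ a ∧ (x : ℕ) + 1 ≠ a
  let idx : Finset (Σ _ : Fin n, Finset (Fin n)) :=
    (Finset.Ici ⟨2, by omega⟩).sigma fun a => Finset.powersetCard (p - 1) (pts a)
  have hidx : ∀ q, q ∈ idx ↔ 2 ≤ (q.1 : ℕ) ∧ Avoids q.1 q.2 ∧ q.2.card + 1 = p := by
    rintro ⟨a, A⟩
    simp only [idx, pts, Finset.mem_sigma, Finset.mem_Ici, Fin.le_def, Finset.mem_powersetCard,
      Avoids, Finset.subset_iff, Finset.mem_filter, Finset.mem_univ, true_and]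
    refine and_congr_right fun _ => and_congr_right fun _ => ?_
    omega
  have hpts : ∀ a ∈ Finset.Ici (⟨2, by omega⟩ : Fin n), (pts a).card = n - 3 := by
    intro a ha
    rw [Finset.mem_Ici, Fin.le_def] at ha
    simp only at ha
    obtain ⟨b, hb⟩ := exists_pred ha
    have : pts a = ({⟨0, by omega⟩, b, a} : Finset (Fin n))ᶜ := by
      ext x
      simp only [pts, Finset.mem_filter, Finset.mem_univ, true_and, Finset.mem_compl,
        Finset.mem_insert, Finset.mem_singleton, not_or, Fin.ext_iff, ne_eq]
      omega
    rw [this, Finset.card_compl, Fintype.card_fin, Finset.card_eq_three.2]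
    refine ⟨_, _, _, ?_, ?_, ?_, rfl⟩ <;> simp only [ne_eq, Fin.ext_iff] <;> omega
  have e : {f : PT n | ∃ (a : Fin n) (A : Finset (Fin n)),
      2 ≤ (a : ℕ) ∧ Avoids a A ∧ A.card + 1 = p ∧ step a A = f} =
      (fun q : Σ _ : Fin n, Finset (Fin n) => step q.1 q.2) '' ↑idx := by
    ext f
    constructor
    · rintro ⟨a, A, h1, h2, h3, h4⟩
      exact ⟨⟨a, A⟩, (hidx _).2 ⟨h1, h2, h3⟩, h4⟩
    · rintro ⟨⟨a, A⟩, h, h4⟩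
      obtain ⟨h1, h2, h3⟩ := (hidx _).1 h
      exact ⟨a, A, h1, h2, h3, h4⟩
  rw [e, Set.InjOn.ncard_image, Set.ncard_coe_finset, Finset.card_sigma,
    Finset.sum_congr rfl fun a ha => by rw [Finset.card_powersetCard, hpts a ha],
    Finset.sum_const, Fin.card_Ici, smul_eq_mul]
  rintro ⟨a, A⟩ h ⟨a', A'⟩ h' heq
  obtain ⟨h1, h2, -⟩ := (hidx _).1 h
  obtain ⟨h1', h2', -⟩ := (hidx _).1 h'
  simp only at h1 h2 h1' h2' heq
  obtain ⟨b, hb⟩ := exists_pred h1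
  have haa : a = a' := by
    have hs := step_self h2 hb
    rw [heq, step_eq_some h2'] at hs
    rcases hs with ⟨h, -⟩ | ⟨h, -⟩
    · exact h
    · subst h; omega
  subst haa
  have hd := congrArg domF heq
  rw [domF_step h2 h1, domF_step h2' h1] at hd
  have hna : a ∉ A := fun h => (h2 a h).2.1 rfl
  have hna' : a ∉ A' := fun h => (h2' a h).2.1 rfl
  have : A = A' := by
    rw [← Finset.erase_insert hna, hd, Finset.erase_insert hna']
  rw [this]

lemma ncard_gens {p : ℕ} (hn : 3 ≤ n) (hp1 : 1 ≤ p) (hp : p < n) :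
    (gens n p).ncard = n.choose p + (n - 2) * (n - 3).choose (p - 1) := by
  have := finite_PT (n := n)
  rw [gens, Set.ncard_union_eq, ncard_runShift hp, ncard_step hn hp1]
  rw [Set.disjoint_left]
  rintro f ⟨B, hB, rfl⟩ ⟨a, A, ha, hA, hc, h⟩
  obtain ⟨b, hb⟩ := exists_pred ha
  have hs := step_self hA hb
  rw [h, runShift_eq_some] at hs
  rcases hs with ⟨-, ⟨h', -⟩ | ⟨-, hr⟩⟩
  · subst h'; omega
  · obtain ⟨x, hx⟩ := runShift_surj (B := B) (by omega)
      (hr ⟨0, a.pos⟩ (by rw [Fin.le_def]; simp))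
    rw [← h, step_eq_some hA] at hx
    rcases hx with ⟨-, h2⟩ | ⟨h1, h2⟩
    · simp only at h2; omega
    · exact (hA x h2).1 (by rw [h1])

/-- for `n ≥ 3` and `1 ≤ p ≤ n-2`, the rank of the semigroup `M(n,p)`
is `C(n,p) + (n-2)·C(n-3,p-1)`. -/
theorem stmt18 (n p : ℕ) (hn : 3 ≤ n) (hp1 : 1 ≤ p) (hp2 : p ≤ n - 2) :
    IsLeast
      {k : ℕ | ∃ A : Set (PT n),
        A ⊆ Mnp n p ∧ (↑(Subsemigroup.closure A) : Set (PT n)) = Mnp n p ∧ A.ncard = k}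
      (Nat.choose n p + (n - 2) * Nat.choose (n - 3) (p - 1)) := by
  have hp : p + 2 ≤ n := by omega
  have := finite_PT (n := n)
  rw [← ncard_gens hn hp1 (by omega)]
  refine ⟨⟨gens n p, gens_subset (by omega), closure_gens hp, rfl⟩, ?_⟩
  rintro k ⟨A, -, hA, rfl⟩
  refine Set.ncard_le_ncard fun f hf => ?_
  exact mem_of_isIrred hA (gens_subset (by omega) hf) (isIrred_of_mem_gens (by omega) hf)

end ICCatalan
end
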